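/- Let A be a real symmetric N×N Z-matrix with connectivity at most W_c for some W_c ≥ 2, let u be a vector with all entries positive, and let φ be an ℓ²-normalized eigenvector of A with eigenvalue E > 0. Set ρ = ρ_{A,u,E}, v = (v_i), and K_E as in the definitions. Then Σ_{k∈[N]} φ_k² e^{2ρ(k,K_E)/√W_c} v_k ≤ W_c · max_{i,j∈[N]} |a_{ij}|. -/

import Mathlib

open scoped ENNReal BigOperators
open Matrix

/-- The effective potential `(Au)_i / u_i`. -/
noncomputable def effV {N : ℕ} (A : Matrix (Fin N) (Fin N) ℝ) (u : Fin N → ℝ) (i : Fin N) : ℝ :=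
  A.mulVec u i / u i

/-- The shifted effective potential `v_i = ((Au)_i/u_i - E)_+`. -/
noncomputable def shiftedV {N : ℕ} (A : Matrix (Fin N) (Fin N) ℝ) (u : Fin N → ℝ) (E : ℝ)
    (i : Fin N) : ℝ :=
  max (effV A u i - E) 0

/-- The weight of an edge `(i,j)`: `ln(1 + √(√(v_i v_j)/|a_ij|))`. -/
noncomputable def edgeW {N : ℕ} (A : Matrix (Fin N) (Fin N) ℝ) (u : Fin N → ℝ) (E : ℝ)
    (i j : Fin N) : ℝ≥0∞ :=
  ENNReal.ofReal
    (Real.log (1 + Real.sqrt (Real.sqrt (shiftedV A u E i * shiftedV A u E j) / |A i j|)))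

/-- The Agmon-type distance `ρ_{A,u,E}(i,j)`: infimum over paths `i = i_0, …, i_L = j` with
`a_{i_ℓ i_{ℓ+1}} ≠ 0` of the total edge weight; `∞` if there is no such path. -/
noncomputable def agmonDist {N : ℕ} (A : Matrix (Fin N) (Fin N) ℝ) (u : Fin N → ℝ) (E : ℝ)
    (i j : Fin N) : ℝ≥0∞ :=
  ⨅ (L : ℕ) (p : Fin (L + 1) → Fin N) (_ : p 0 = i) (_ : p (Fin.last L) = j)
    (_ : ∀ ℓ : Fin L, A (p ℓ.castSucc) (p ℓ.succ) ≠ 0),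
    ∑ ℓ : Fin L, edgeW A u E (p ℓ.castSucc) (p ℓ.succ)

/-- `ρ(i, M) = inf_{j ∈ M} ρ(i,j)` (`∞` when `M = ∅`). -/
noncomputable def agmonDistToSet {N : ℕ} (A : Matrix (Fin N) (Fin N) ℝ) (u : Fin N → ℝ) (E : ℝ)
    (i : Fin N) (M : Finset (Fin N)) : ℝ≥0∞ :=
  ⨅ j ∈ M, agmonDist A u E i j

/-- The well set `K_E = {i : v_i = 0} = {i : (Au)_i/u_i ≤ E}`. -/
noncomputable def wellSet {N : ℕ} (A : Matrix (Fin N) (Fin N) ℝ) (u : Fin N → ℝ) (E : ℝ) :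
    Finset (Fin N) :=
  Finset.univ.filter fun i => effV A u i ≤ E

/-- A `Z`-matrix: nonpositive off-diagonal entries. -/
def IsZMatrix {N : ℕ} (A : Matrix (Fin N) (Fin N) ℝ) : Prop :=
  ∀ i j, i ≠ j → A i j ≤ 0

/-- Connectivity at most `W`: every row and column has at most `W` nonzero off-diagonal
entries. -/
def ConnAtMost {N : ℕ} (A : Matrix (Fin N) (Fin N) ℝ) (W : ℕ) : Prop :=
  ∀ i : Fin N, (Finset.univ.filter fun j => j ≠ i ∧ A i j ≠ 0).card ≤ W ∧
    (Finset.univ.filter fun j => j ≠ i ∧ A j i ≠ 0).card ≤ W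

/-- `φ` is a local eigenvector of `A` on `M` with eigenvalue `E`: `φ ≠ 0`, `I_M φ = φ`, and
`I_M A I_M φ = E φ`. -/
def IsLocalEigenvector {N : ℕ} (A : Matrix (Fin N) (Fin N) ℝ) (M : Finset (Fin N)) (E : ℝ)
    (φ : Fin N → ℝ) : Prop :=
  φ ≠ 0 ∧ (∀ i, i ∉ M → φ i = 0) ∧ (∀ i, i ∈ M → A.mulVec φ i = E * φ i)

/-- Extended exponential `e^x` for `x ∈ [0,∞]`. -/
noncomputable def eexp (x : ℝ≥0∞) : ℝ≥0∞ :=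
  if x = ⊤ then ⊤ else ENNReal.ofReal (Real.exp x.toReal)

section Agmon

variable {N : ℕ} {A : Matrix (Fin N) (Fin N) ℝ} {u φ : Fin N → ℝ} {E : ℝ}

/-- Agmon-type energy inequality for a `Z`-matrix, via the ground state substitution `φ = u · f`. -/
theorem sum_effV_sub_mul_sq_le (hA : A.IsSymm) (hZ : IsZMatrix A) (hu : ∀ i, 0 < u i)
    (heig : A.mulVec φ = E • φ) (g : Fin N → ℝ) :
    ∑ i, (effV A u i - E) * (g i * φ i) ^ 2 ≤
      (1 / 2) * ∑ i, ∑ j, |A i j| * (|φ i| * |φ j|) * (g i - g j) ^ 2 := by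
  have hV : ∑ i, effV A u i * (g i * φ i) ^ 2 =
      ∑ i, ∑ j, A i j * (u j / u i) * (g i * φ i) ^ 2 := by
    refine Finset.sum_congr rfl fun i _ => ?_
    rw [effV, Matrix.mulVec, dotProduct, Finset.sum_div, Finset.sum_mul]
    exact Finset.sum_congr rfl fun j _ => by ring
  have hV' : ∑ i, effV A u i * (g i * φ i) ^ 2 =
      ∑ i, ∑ j, A i j * (u i / u j) * (g j * φ j) ^ 2 := by
    rw [hV, Finset.sum_comm]
    refine Finset.sum_congr rfl fun i _ => Finset.sum_congr rfl fun j _ => ?_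
    rw [hA.apply i j]
  have hE : ∑ i, E * (g i * φ i) ^ 2 = ∑ i, ∑ j, A i j * (φ i * φ j) * g i ^ 2 := by
    refine Finset.sum_congr rfl fun i _ => ?_
    have h := congrFun heig i
    simp only [Matrix.mulVec, dotProduct, Pi.smul_apply, smul_eq_mul] at h
    calc E * (g i * φ i) ^ 2 = (E * φ i) * (φ i * g i ^ 2) := by ring
      _ = ∑ j, A i j * (φ i * φ j) * g i ^ 2 := by
        rw [← h, Finset.sum_mul]
        exact Finset.sum_congr rfl fun j _ => by ring
  have hE' : ∑ i, E * (g i * φ i) ^ 2 = ∑ i, ∑ j, A i j * (φ i * φ j) * g j ^ 2 := by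
    rw [hE, Finset.sum_comm]
    refine Finset.sum_congr rfl fun i _ => Finset.sum_congr rfl fun j _ => ?_
    rw [hA.apply i j]
    ring
  have key : ∀ i j, A i j * (u j / u i) * (g i * φ i) ^ 2 + A i j * (u i / u j) * (g j * φ j) ^ 2
      - (A i j * (φ i * φ j) * g i ^ 2 + A i j * (φ i * φ j) * g j ^ 2) ≤
      |A i j| * (|φ i| * |φ j|) * (g i - g j) ^ 2 := by
    intro i j
    have hi := (hu i).ne'
    have hj := (hu j).ne'
    rcases eq_or_ne i j with rfl | hij
    · rw [div_self hi]
      apply le_of_eq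
      ring
    · have ha := hZ i j hij
      have h1 : A i j * (u j / u i) * (g i * φ i) ^ 2 + A i j * (u i / u j) * (g j * φ j) ^ 2
          - 2 * A i j * (g i * φ i) * (g j * φ j) =
          A i j * (u i * u j * (g i * φ i / u i - g j * φ j / u j) ^ 2) := by
        field_simp
        ring
      have h2 : A i j * (u i * u j * (g i * φ i / u i - g j * φ j / u j) ^ 2) ≤ 0 :=
        mul_nonpos_of_nonpos_of_nonneg ha
          (mul_nonneg (mul_pos (hu i) (hu j)).le (sq_nonneg _))
      have h3 : -(A i j * (φ i * φ j)) ≤ |A i j| * (|φ i| * |φ j|) := by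
        rw [← abs_mul, ← abs_mul]
        exact neg_le_abs _
      have h4 := mul_le_mul_of_nonneg_right h3 (sq_nonneg (g i - g j))
      linarith
  have hsum := Finset.sum_le_sum fun i (_ : i ∈ Finset.univ) =>
    Finset.sum_le_sum fun j (_ : j ∈ Finset.univ) => key i j
  simp only [Finset.sum_add_distrib, Finset.sum_sub_distrib] at hsum
  rw [← hV, ← hV', ← hE, ← hE'] at hsum
  simp only [sub_mul, Finset.sum_sub_distrib]
  linarith

theorem agmonDist_self (i : Fin N) : agmonDist A u E i i = 0 := by
  refine le_antisymm ?_ zero_le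
  refine iInf_le_of_le 0 (iInf_le_of_le (fun _ => i) (iInf_le_of_le rfl (iInf_le_of_le rfl
    (iInf_le_of_le (fun ℓ => ℓ.elim0) ?_))))
  simp

theorem agmonDist_le_edgeW_add {i j : Fin N} (h : A i j ≠ 0) (k : Fin N) :
    agmonDist A u E i k ≤ edgeW A u E i j + agmonDist A u E j k := by
  simp only [agmonDist, ENNReal.add_iInf]
  refine le_iInf fun L => le_iInf fun p => le_iInf fun h0 => le_iInf fun hl => le_iInf fun hp => ?_
  refine iInf_le_of_le (L + 1) (iInf_le_of_le (Fin.cons i p) (iInf_le_of_le rfl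
    (iInf_le_of_le ?_ (iInf_le_of_le ?_ ?_))))
  · rw [← Fin.succ_last, Fin.cons_succ, hl]
  · intro ℓ
    refine Fin.cases ?_ (fun m => ?_) ℓ
    · simpa [h0] using h
    · simpa [← Fin.succ_castSucc] using hp m
  · rw [Fin.sum_univ_succ]
    simp [h0]

theorem agmonDistToSet_le_edgeW_add {i j : Fin N} (h : A i j ≠ 0) (M : Finset (Fin N)) :
    agmonDistToSet A u E i M ≤ edgeW A u E i j + agmonDistToSet A u E j M := by
  simp only [agmonDistToSet, ENNReal.add_iInf]
  exact le_iInf₂ fun k hk => iInf₂_le_of_le k hk (agmonDist_le_edgeW_add h k)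

theorem agmonDistToSet_eq_zero_of_mem {i : Fin N} {M : Finset (Fin N)} (h : i ∈ M) :
    agmonDistToSet A u E i M = 0 :=
  le_antisymm (iInf₂_le_of_le i h (agmonDist_self i).le) zero_le

theorem agmonDistToSet_eq_top_of_adj {i j : Fin N} (h : A i j ≠ 0) {M : Finset (Fin N)}
    (hi : agmonDistToSet A u E i M = ⊤) : agmonDistToSet A u E j M = ⊤ := by
  have := agmonDistToSet_le_edgeW_add (u := u) (E := E) h M
  rw [hi, top_le_iff, ENNReal.add_eq_top] at this
  exact this.resolve_left ENNReal.ofReal_ne_top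

theorem shiftedV_eq_zero_of_mem {i : Fin N} (h : i ∈ wellSet A u E) : shiftedV A u E i = 0 := by
  simp only [wellSet, Finset.mem_filter, Finset.mem_univ, true_and] at h
  exact max_eq_right (by linarith)

theorem lt_effV_of_notMem {i : Fin N} (h : i ∉ wellSet A u E) : E < effV A u i := by
  simpa [wellSet] using h

theorem shiftedV_nonneg (i : Fin N) : 0 ≤ shiftedV A u E i := le_max_right _ _

theorem agmonDistToSet_eq_zero_of_adj {i j : Fin N} (h : A i j ≠ 0) (hj : j ∈ wellSet A u E) :
    agmonDistToSet A u E i (wellSet A u E) = 0 := by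
  have := agmonDistToSet_le_edgeW_add (u := u) (E := E) h (wellSet A u E)
  rw [agmonDistToSet_eq_zero_of_mem hj, edgeW, shiftedV_eq_zero_of_mem hj] at this
  simpa using this

/-- An eigenvector vanishes on the connected components that do not meet the well set. -/
theorem eigenvector_eq_zero_of_agmonDistToSet_eq_top (hA : A.IsSymm) (hZ : IsZMatrix A)
    (hu : ∀ i, 0 < u i) (heig : A.mulVec φ = E • φ) {k : Fin N}
    (hk : agmonDistToSet A u E k (wellSet A u E) = ⊤) : φ k = 0 := by
  classical
  set D := fun i => agmonDistToSet A u E i (wellSet A u E) with hD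
  have h := sum_effV_sub_mul_sq_le hA hZ hu heig fun i => if D i = ⊤ then 1 else 0
  have hR : ∑ i, ∑ j, |A i j| * (|φ i| * |φ j|) *
      ((if D i = ⊤ then 1 else 0) - (if D j = ⊤ then 1 else 0) : ℝ) ^ 2 = 0 := by
    refine Finset.sum_eq_zero fun i _ => Finset.sum_eq_zero fun j _ => ?_
    by_cases ha : A i j = 0
    · simp [ha]
    · have : D i = ⊤ ↔ D j = ⊤ := ⟨agmonDistToSet_eq_top_of_adj ha,
        agmonDistToSet_eq_top_of_adj (by rwa [hA.apply i j])⟩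
      simp [this]
  have hV : ∀ i, D i = ⊤ → E < effV A u i := fun i hi => lt_effV_of_notMem fun hm => by
    simp [hD, agmonDistToSet_eq_zero_of_mem hm] at hi
  have hnn : ∀ i ∈ Finset.univ,
      0 ≤ (effV A u i - E) * ((if D i = ⊤ then 1 else 0) * φ i) ^ 2 := by
    intro i _
    split_ifs with hi
    · exact mul_nonneg (by linarith [hV i hi]) (sq_nonneg _)
    · simp
  rw [hR, mul_zero] at h
  have h0 := (Finset.sum_eq_zero_iff_of_nonneg hnn).1 (le_antisymm h (Finset.sum_nonneg hnn)) k
    (Finset.mem_univ k)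
  rw [if_pos hk, one_mul] at h0
  rcases mul_eq_zero.1 h0 with h0 | h0
  · linarith [hV k hk]
  · exact pow_eq_zero_iff two_ne_zero |>.1 h0

theorem sq_sub_le_mul_mul_sq {a b t : ℝ} (ha : 0 ≤ a) (hb : 0 ≤ b)
    (hab : a ≤ b * (1 + t)) (hba : b ≤ a * (1 + t)) : (a - b) ^ 2 ≤ a * b * t ^ 2 := by
  rcases le_total a b with h | h
  · calc (a - b) ^ 2 = (b - a) ^ 2 := by ring
      _ ≤ (a * t) ^ 2 := pow_le_pow_left₀ (by linarith) (by linarith) 2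
      _ = a * a * t ^ 2 := by ring
      _ ≤ a * b * t ^ 2 := by gcongr
  · calc (a - b) ^ 2 ≤ (b * t) ^ 2 := pow_le_pow_left₀ (by linarith) (by linarith) 2
      _ = b * b * t ^ 2 := by ring
      _ ≤ a * b * t ^ 2 := by gcongr

theorem exp_div_le_of_le_log_one_add {c r s x : ℝ} (hc : 1 ≤ c) (hx : 0 ≤ x)
    (h : r ≤ Real.log (1 + x) + s) :
    Real.exp (r / c) ≤ Real.exp (s / c) * (1 + x / c) := by
  have hc0 : 0 < c := by linarith
  have h1 : Real.exp (Real.log (1 + x) / c) ≤ 1 + x / c := by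
    have := rpow_one_add_le_one_add_mul_self (s := x) (p := 1 / c) (by linarith)
      (by positivity) ((div_le_one hc0).2 hc)
    rw [Real.rpow_def_of_pos (by linarith)] at this
    calc _ = Real.exp (Real.log (1 + x) * (1 / c)) := by rw [mul_one_div]
      _ ≤ _ := this
      _ = _ := by ring
  calc Real.exp (r / c) ≤ Real.exp (s / c + Real.log (1 + x) / c) := by
        rw [← add_div, add_comm s]
        gcongr
    _ = Real.exp (s / c) * Real.exp (Real.log (1 + x) / c) := Real.exp_add _ _
    _ ≤ _ := by gcongr

/-- The weight `e^{ρ(i,K_E)/c}`, cut off to `0` on the well set and where `ρ = ∞`. -/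
noncomputable def agmonWeight (A : Matrix (Fin N) (Fin N) ℝ) (u : Fin N → ℝ) (E c : ℝ)
    (i : Fin N) : ℝ :=
  open Classical in
  if i ∈ wellSet A u E ∨ agmonDistToSet A u E i (wellSet A u E) = ⊤ then 0
  else Real.exp ((agmonDistToSet A u E i (wellSet A u E)).toReal / c)

theorem agmonWeight_of_mem {c : ℝ} {i : Fin N} (h : i ∈ wellSet A u E) :
    agmonWeight A u E c i = 0 := if_pos (Or.inl h)

theorem agmonWeight_of_eq_top {c : ℝ} {i : Fin N}
    (h : agmonDistToSet A u E i (wellSet A u E) = ⊤) : agmonWeight A u E c i = 0 :=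
  if_pos (Or.inr h)

theorem agmonWeight_of_notMem {c : ℝ} {i : Fin N} (h : i ∉ wellSet A u E)
    (h' : agmonDistToSet A u E i (wellSet A u E) ≠ ⊤) :
    agmonWeight A u E c i =
      Real.exp ((agmonDistToSet A u E i (wellSet A u E)).toReal / c) :=
  if_neg (by tauto)

theorem agmonWeight_of_adj {c : ℝ} {i j : Fin N} (h : A i j ≠ 0) (hi : i ∉ wellSet A u E)
    (hj : j ∈ wellSet A u E) : agmonWeight A u E c i = 1 := by
  have h0 := agmonDistToSet_eq_zero_of_adj h hj
  rw [agmonWeight_of_notMem hi (by simp [h0]), h0]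
  simp

theorem agmonWeight_nonneg {c : ℝ} (i : Fin N) : 0 ≤ agmonWeight A u E c i := by
  unfold agmonWeight
  split_ifs <;> positivity

theorem agmonWeight_le_mul {c : ℝ} (hc : 1 ≤ c) {i j : Fin N} (h : A i j ≠ 0)
    (hi : i ∉ wellSet A u E) (hj : j ∉ wellSet A u E)
    (hit : agmonDistToSet A u E i (wellSet A u E) ≠ ⊤)
    (hjt : agmonDistToSet A u E j (wellSet A u E) ≠ ⊤) :
    agmonWeight A u E c i ≤ agmonWeight A u E c j *
      (1 + √(√(shiftedV A u E i * shiftedV A u E j) / |A i j|) / c) := by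
  rw [agmonWeight_of_notMem hi hit, agmonWeight_of_notMem hj hjt]
  refine exp_div_le_of_le_log_one_add hc (Real.sqrt_nonneg _) ?_
  have h1 := ENNReal.toReal_mono (ENNReal.add_ne_top.2 ⟨ENNReal.ofReal_ne_top, hjt⟩)
    (agmonDistToSet_le_edgeW_add (u := u) (E := E) h (wellSet A u E))
  have h2 : 0 ≤ Real.log (1 + √(√(shiftedV A u E i * shiftedV A u E j) / |A i j|)) :=
    Real.log_nonneg (le_add_of_nonneg_right (Real.sqrt_nonneg _))
  rwa [ENNReal.toReal_add ENNReal.ofReal_ne_top hjt, ENNReal.toReal_ofReal h2] at h1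

theorem abs_mul_sq_agmonWeight_sub_le (hA : A.IsSymm) {c : ℝ} (hc : 1 ≤ c) {i j : Fin N}
    (h : A i j ≠ 0) (hi : i ∉ wellSet A u E) (hj : j ∉ wellSet A u E) :
    |A i j| * (agmonWeight A u E c i - agmonWeight A u E c j) ^ 2 ≤
      agmonWeight A u E c i * agmonWeight A u E c j *
        (√(shiftedV A u E i) * √(shiftedV A u E j)) / c ^ 2 := by
  have h' : A j i ≠ 0 := by rwa [hA.apply i j]
  by_cases hit : agmonDistToSet A u E i (wellSet A u E) = ⊤
  · rw [agmonWeight_of_eq_top hit, agmonWeight_of_eq_top (agmonDistToSet_eq_top_of_adj h hit)]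
    simp
  have hjt : agmonDistToSet A u E j (wellSet A u E) ≠ ⊤ :=
    fun hjt => hit (agmonDistToSet_eq_top_of_adj h' hjt)
  have h1 := agmonWeight_le_mul hc h hi hj hit hjt
  have h2 := agmonWeight_le_mul hc h' hj hi hjt hit
  rw [hA.apply i j, mul_comm (shiftedV A u E j)] at h2
  have h3 := mul_le_mul_of_nonneg_left
    (sq_sub_le_mul_mul_sq (agmonWeight_nonneg i) (agmonWeight_nonneg j) h1 h2) (abs_nonneg (A i j))
  refine h3.trans_eq ?_
  rw [div_pow, Real.sq_sqrt (by positivity), Real.sqrt_mul (shiftedV_nonneg i)]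
  have : |A i j| ≠ 0 := abs_ne_zero.2 h
  field_simp

theorem energy_pair_le (hA : A.IsSymm) {c M : ℝ} (hc : 1 ≤ c) {i j : Fin N} (h : A i j ≠ 0)
    (hM : |A i j| ≤ M) :
    |A i j| * (|φ i| * |φ j|) * (agmonWeight A u E c i - agmonWeight A u E c j) ^ 2 ≤
      ((φ i ^ 2 * agmonWeight A u E c i ^ 2 * shiftedV A u E i / c ^ 2 + M * φ i ^ 2) +
        (φ j ^ 2 * agmonWeight A u E c j ^ 2 * shiftedV A u E j / c ^ 2 + M * φ j ^ 2)) / 2 := by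
  have hM0 : 0 ≤ M := (abs_nonneg _).trans hM
  have hvi := shiftedV_nonneg (A := A) (u := u) (E := E) i
  have hvj := shiftedV_nonneg (A := A) (u := u) (E := E) j
  have hφ : |φ i| * |φ j| ≤ (φ i ^ 2 + φ j ^ 2) / 2 := by
    nlinarith [sq_nonneg (|φ i| - |φ j|), sq_abs (φ i), sq_abs (φ j)]
  have hbd : |A i j| * (|φ i| * |φ j|) ≤ M * ((φ i ^ 2 + φ j ^ 2) / 2) := by gcongr
  have hsi : 0 ≤ φ i ^ 2 * agmonWeight A u E c i ^ 2 * shiftedV A u E i / c ^ 2 := by positivity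
  have hsj : 0 ≤ φ j ^ 2 * agmonWeight A u E c j ^ 2 * shiftedV A u E j / c ^ 2 := by positivity
  have hm : 0 ≤ M * ((φ i ^ 2 + φ j ^ 2) / 2) := by positivity
  by_cases hi : i ∈ wellSet A u E <;> by_cases hj : j ∈ wellSet A u E
  · rw [agmonWeight_of_mem hi, agmonWeight_of_mem hj] at *
    linarith
  · have hw : agmonWeight A u E c j = 1 :=
      agmonWeight_of_adj (by rwa [hA.apply i j]) hj hi
    rw [hw] at hsj ⊢
    rw [agmonWeight_of_mem hi] at hsi ⊢
    linarith
  · rw [agmonWeight_of_mem hj, agmonWeight_of_adj h hi hj] at *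
    linarith
  · have h1 := abs_mul_sq_agmonWeight_sub_le hA hc h hi hj
    set a := agmonWeight A u E c i
    set b := agmonWeight A u E c j
    set p := √(shiftedV A u E i)
    set q := √(shiftedV A u E j)
    have hp : p ^ 2 = shiftedV A u E i := Real.sq_sqrt hvi
    have hq : q ^ 2 = shiftedV A u E j := Real.sq_sqrt hvj
    have h2 : |A i j| * (|φ i| * |φ j|) * (a - b) ^ 2 ≤
        (|φ i| * a * p) * (|φ j| * b * q) / c ^ 2 := by
      calc _ = |φ i| * |φ j| * (|A i j| * (a - b) ^ 2) := by ring
        _ ≤ |φ i| * |φ j| * (a * b * (p * q) / c ^ 2) := by gcongr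
        _ = _ := by ring
    have h3 : (|φ i| * a * p) * (|φ j| * b * q) ≤
        (φ i ^ 2 * a ^ 2 * shiftedV A u E i + φ j ^ 2 * b ^ 2 * shiftedV A u E j) / 2 := by
      rw [← hp, ← hq, ← sq_abs (φ i), ← sq_abs (φ j)]
      nlinarith [sq_nonneg (|φ i| * a * p - |φ j| * b * q)]
    have h4 := div_le_div_of_nonneg_right h3 (sq_nonneg c)
    have h5 : (φ i ^ 2 * a ^ 2 * shiftedV A u E i + φ j ^ 2 * b ^ 2 * shiftedV A u E j) / 2 / c ^ 2
      = (φ i ^ 2 * a ^ 2 * shiftedV A u E i / c ^ 2 +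
        φ j ^ 2 * b ^ 2 * shiftedV A u E j / c ^ 2) / 2 := by ring
    linarith

theorem sum_adj_le {W : ℕ} (hconn : ConnAtMost A W) {x : Fin N → ℝ} (hx : ∀ i, 0 ≤ x i) :
    ∑ i, ∑ j, (if j ≠ i ∧ A i j ≠ 0 then (x i + x j) / 2 else 0) ≤ W * ∑ i, x i := by
  classical
  have hrow : ∑ i, ∑ j, (if j ≠ i ∧ A i j ≠ 0 then x i else 0) ≤ W * ∑ i, x i := by
    rw [Finset.mul_sum]
    refine Finset.sum_le_sum fun i _ => ?_
    rw [← Finset.sum_filter, Finset.sum_const, nsmul_eq_mul]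
    exact mul_le_mul_of_nonneg_right (by exact_mod_cast (hconn i).1) (hx i)
  have hcol : ∑ i, ∑ j, (if j ≠ i ∧ A i j ≠ 0 then x j else 0) ≤ W * ∑ i, x i := by
    rw [Finset.mul_sum, Finset.sum_comm]
    refine Finset.sum_le_sum fun i _ => ?_
    rw [← Finset.sum_filter, Finset.sum_const, nsmul_eq_mul]
    refine mul_le_mul_of_nonneg_right ?_ (hx i)
    simp only [ne_comm (a := i)]
    exact_mod_cast (hconn i).2
  have hsplit : ∑ i, ∑ j, (if j ≠ i ∧ A i j ≠ 0 then (x i + x j) / 2 else 0) =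
      (∑ i, ∑ j, (if j ≠ i ∧ A i j ≠ 0 then x i else 0) +
        ∑ i, ∑ j, (if j ≠ i ∧ A i j ≠ 0 then x j else 0)) / 2 := by
    simp only [← Finset.sum_add_distrib, Finset.sum_div]
    refine Finset.sum_congr rfl fun i _ => Finset.sum_congr rfl fun j _ => ?_
    split_ifs <;> simp
  linarith

theorem sum_sq_mul_agmonWeight_sq_mul_shiftedV_le (hA : A.IsSymm) (hZ : IsZMatrix A) {W : ℕ}
    (hW : 1 ≤ W) (hconn : ConnAtMost A W) (hu : ∀ i, 0 < u i) (hnorm : ∑ k, φ k ^ 2 = 1)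
    (heig : A.mulVec φ = E • φ) {M : ℝ} (hM0 : 0 ≤ M) (hM : ∀ i j, |A i j| ≤ M) :
    ∑ k, φ k ^ 2 * agmonWeight A u E (√W) k ^ 2 * shiftedV A u E k ≤ W * M := by
  have hW1 : (1 : ℝ) ≤ W := by exact_mod_cast hW
  have hW0 : (0 : ℝ) < W := by linarith
  have hc : 1 ≤ √(W : ℝ) := Real.one_le_sqrt.2 hW1
  have hc2 : √(W : ℝ) ^ 2 = W := Real.sq_sqrt (by linarith)
  set g := agmonWeight A u E (√W) with hg
  set s := fun k => φ k ^ 2 * g k ^ 2 * shiftedV A u E k with hs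
  have hs0 : ∀ k, 0 ≤ s k := fun k => mul_nonneg (by positivity) (shiftedV_nonneg k)
  have hlhs : ∑ i, (effV A u i - E) * (g i * φ i) ^ 2 = ∑ k, s k := by
    refine Finset.sum_congr rfl fun i _ => ?_
    by_cases hi : i ∈ wellSet A u E
    · simp [hs, hg, agmonWeight_of_mem hi]
    · have hv : shiftedV A u E i = effV A u i - E :=
        max_eq_left (by linarith [lt_effV_of_notMem hi])
      simp only [hs, hv]
      ring
  have hpair : ∑ i, ∑ j, |A i j| * (|φ i| * |φ j|) * (g i - g j) ^ 2 ≤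
      W * ∑ i, (s i / W + M * φ i ^ 2) := by
    refine le_trans ?_ (sum_adj_le hconn fun i =>
      add_nonneg (div_nonneg (hs0 i) hW0.le) (mul_nonneg hM0 (sq_nonneg (φ i))))
    refine Finset.sum_le_sum fun i _ => Finset.sum_le_sum fun j _ => ?_
    split_ifs with h
    · have := energy_pair_le (φ := φ) (u := u) (E := E) hA hc h.2 (hM i j)
      rwa [hc2] at this
    · rcases not_and_or.1 h with h | h
      · simp [not_not.1 h]
      · simp [not_not.1 h]
  have hsum : W * ∑ i, (s i / W + M * φ i ^ 2) = ∑ i, s i + W * M := by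
    rw [Finset.sum_add_distrib, ← Finset.sum_div, ← Finset.mul_sum, hnorm]
    field_simp
  have := sum_effV_sub_mul_sq_le hA hZ hu heig g
  linarith

end Agmon

/-- Let `A` be a real symmetric `N×N` `Z`-matrix with connectivity at most
`W_c ≥ 2`, `u` a vector with positive entries, and `φ` an `ℓ²`-normalized eigenvector of `A`
with eigenvalue `E > 0`. Then
`∑_k φ_k² e^{2ρ(k,K_E)/√W_c} v_k ≤ W_c · max_{i,j} |a_{ij}|`. -/
theorem exponential_localization_global {N : ℕ} (A : Matrix (Fin N) (Fin N) ℝ)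
    (hA : A.IsSymm) (hZ : IsZMatrix A) (Wc : ℕ) (hWc : 2 ≤ Wc) (hconn : ConnAtMost A Wc)
    (u : Fin N → ℝ) (hu : ∀ i, 0 < u i) (φ : Fin N → ℝ) (E : ℝ) (hE : 0 < E)
    (hnorm : ∑ k : Fin N, φ k ^ 2 = 1) (heig : A.mulVec φ = E • φ) :
    ∑ k : Fin N, ENNReal.ofReal (φ k ^ 2) *
        eexp (ENNReal.ofReal (2 / Real.sqrt Wc) * agmonDistToSet A u E k (wellSet A u E)) *
        ENNReal.ofReal (shiftedV A u E k)
      ≤ ENNReal.ofReal (Wc : ℝ) * ⨆ i : Fin N, ⨆ j : Fin N, ENNReal.ofReal |A i j| := by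
  set S : ℝ≥0∞ := ⨆ i : Fin N, ⨆ j : Fin N, ENNReal.ofReal |A i j| with hS
  have hStop : S ≠ ⊤ :=
    iSup_ne_top fun i => iSup_ne_top fun j => ENNReal.ofReal_ne_top
  have hM : ∀ i j, |A i j| ≤ S.toReal := fun i j => by
    rw [← ENNReal.ofReal_le_iff_le_toReal hStop]
    exact le_iSup₂ (f := fun i j => ENNReal.ofReal |A i j|) i j
  have hW0 : (0 : ℝ) ≤ Wc := Nat.cast_nonneg _
  have hmain := sum_sq_mul_agmonWeight_sq_mul_shiftedV_le hA hZ (by omega) hconn hu hnorm heig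
    ENNReal.toReal_nonneg hM
  have hterm : ∀ k, ENNReal.ofReal (φ k ^ 2) *
      eexp (ENNReal.ofReal (2 / Real.sqrt Wc) * agmonDistToSet A u E k (wellSet A u E)) *
      ENNReal.ofReal (shiftedV A u E k) =
      ENNReal.ofReal (φ k ^ 2 * agmonWeight A u E (√Wc) k ^ 2 * shiftedV A u E k) := by
    intro k
    by_cases hk : k ∈ wellSet A u E
    · simp [shiftedV_eq_zero_of_mem hk]
    by_cases ht : agmonDistToSet A u E k (wellSet A u E) = ⊤
    · simp [eigenvector_eq_zero_of_agmonDistToSet_eq_top hA hZ hu heig ht]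
    rw [ENNReal.ofReal_mul (by positivity), ENNReal.ofReal_mul (by positivity), eexp,
      if_neg (ENNReal.mul_ne_top ENNReal.ofReal_ne_top ht), agmonWeight_of_notMem hk ht,
      ENNReal.toReal_mul, ENNReal.toReal_ofReal (by positivity), ← Real.exp_nat_mul]
    congr 4
    push_cast
    ring
  rw [Finset.sum_congr rfl fun k _ => hterm k, ← ENNReal.ofReal_sum_of_nonneg fun k _ =>
    mul_nonneg (by positivity) (shiftedV_nonneg k), ← ENNReal.ofReal_toReal hStop,
    ← ENNReal.ofReal_mul hW0]
  exact ENNReal.ofReal_le_ofReal hmain
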